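/- In CK, the universal uniform interpolant of an implication is equivalent to its relativisation by the existential uniform interpolant of the antecedent: let φ, ψ be formulas and p a propositional variable; let A be any formula with vars(A) ⊆ vars(φ→ψ)\{p}, ⊢_CK A → (φ→ψ), and such that for every χ with p ∉ vars(χ), ⊢_CK χ → (φ→ψ) implies ⊢_CK χ → A (i.e., A is a uniform pre-interpolant of φ→ψ w.r.t. p); and let B be any formula with vars(B) ⊆ vars(φ)\{p}, ⊢_CK φ → B, and such that for every χ with p ∉ vars(χ), ⊢_CK φ → χ implies ⊢_CK B → χ (i.e., B is a uniform post-interpolant of φ w.r.t. p). Then ⊢_CK A → (B → A) and ⊢_CK (B → A) → A; in particular ⊢_CK A if and only if ⊢_CK B → A. -/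

import Mathlib

/-- Formulas of the modal language: φ ::= p | ⊥ | φ∧φ | φ∨φ | φ→φ | □φ | ◇φ. -/
inductive Form : Type
  | var : ℕ → Form
  | bot : Form
  | and : Form → Form → Form
  | or  : Form → Form → Form
  | imp : Form → Form → Form
  | box : Form → Form
  | dia : Form → Form
  deriving DecidableEq

/-- Helper for □⁻¹: remove an outer box. -/
def unboxF : Form → Option Form
  | Form.box φ => some φ
  | _ => none

/-- □⁻¹Γ := {φ | □φ ∈ Γ}, as a multiset operation. -/
def boxInv (Γ : Multiset Form) : Multiset Form := Γ.filterMap unboxF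

/-- ◇⁻¹Δ for a succedent Δ with at most one formula (modelled by `Option`). -/
def diaInv : Option Form → Option Form
  | some (Form.dia φ) => some φ
  | _ => none

/-- Provability in the sequent calculus G4CK: sequents Γ ⇒ δ with a
multiset antecedent and a single-formula succedent. -/
inductive G4CK : Multiset Form → Form → Prop
  | botL (Γ δ) : G4CK (Form.bot ::ₘ Γ) δ
  | idP (Γ n) : G4CK (Form.var n ::ₘ Γ) (Form.var n)
  | andL (Γ φ ψ δ) : G4CK (φ ::ₘ ψ ::ₘ Γ) δ → G4CK (Form.and φ ψ ::ₘ Γ) δ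
  | andR (Γ φ ψ) : G4CK Γ φ → G4CK Γ ψ → G4CK Γ (Form.and φ ψ)
  | orL (Γ φ ψ δ) : G4CK (φ ::ₘ Γ) δ → G4CK (ψ ::ₘ Γ) δ → G4CK (Form.or φ ψ ::ₘ Γ) δ
  | orR1 (Γ φ ψ) : G4CK Γ φ → G4CK Γ (Form.or φ ψ)
  | orR2 (Γ φ ψ) : G4CK Γ ψ → G4CK Γ (Form.or φ ψ)
  | impR (Γ φ ψ) : G4CK (φ ::ₘ Γ) ψ → G4CK Γ (Form.imp φ ψ)
  | andImpL (Γ φ ψ χ δ) :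
      G4CK (Form.imp φ (Form.imp ψ χ) ::ₘ Γ) δ →
      G4CK (Form.imp (Form.and φ ψ) χ ::ₘ Γ) δ
  | orImpL (Γ φ ψ χ δ) :
      G4CK (Form.imp φ χ ::ₘ Form.imp ψ χ ::ₘ Γ) δ →
      G4CK (Form.imp (Form.or φ ψ) χ ::ₘ Γ) δ
  | pImpL (Γ n φ δ) :
      G4CK (Form.var n ::ₘ φ ::ₘ Γ) δ →
      G4CK (Form.var n ::ₘ Form.imp (Form.var n) φ ::ₘ Γ) δ
  | impImpL (Γ φ ψ χ δ) :
      G4CK (Form.imp ψ χ ::ₘ Γ) (Form.imp φ ψ) → G4CK (χ ::ₘ Γ) δ →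
      G4CK (Form.imp (Form.imp φ ψ) χ ::ₘ Γ) δ
  | boxR (Γ φ) : G4CK (boxInv Γ) φ → G4CK Γ (Form.box φ)
  | boxImpL (Γ φ ψ δ) :
      G4CK (boxInv Γ) φ → G4CK (ψ ::ₘ Γ) δ →
      G4CK (Form.imp (Form.box φ) ψ ::ₘ Γ) δ
  | diaImpL (Γ γ φ ψ δ) :
      G4CK (γ ::ₘ boxInv Γ) φ → G4CK (ψ ::ₘ Form.dia γ ::ₘ Γ) δ →
      G4CK (Form.imp (Form.dia φ) ψ ::ₘ Form.dia γ ::ₘ Γ) δ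
  | diaL (Γ φ ψ) : G4CK (φ ::ₘ boxInv Γ) ψ → G4CK (Form.dia φ ::ₘ Γ) (Form.dia ψ)

/-- Provability in the sequent calculus G4WK: sequents Γ ⇒ Δ with a
multiset antecedent and a succedent with at most one formula (`Option Form`). -/
inductive G4WK : Multiset Form → Option Form → Prop
  | botL (Γ Δ) : G4WK (Form.bot ::ₘ Γ) Δ
  | idP (Γ n) : G4WK (Form.var n ::ₘ Γ) (some (Form.var n))
  | andL (Γ φ ψ Δ) : G4WK (φ ::ₘ ψ ::ₘ Γ) Δ → G4WK (Form.and φ ψ ::ₘ Γ) Δ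
  | andR (Γ φ ψ) : G4WK Γ (some φ) → G4WK Γ (some ψ) → G4WK Γ (some (Form.and φ ψ))
  | orL (Γ φ ψ Δ) : G4WK (φ ::ₘ Γ) Δ → G4WK (ψ ::ₘ Γ) Δ → G4WK (Form.or φ ψ ::ₘ Γ) Δ
  | orR1 (Γ φ ψ) : G4WK Γ (some φ) → G4WK Γ (some (Form.or φ ψ))
  | orR2 (Γ φ ψ) : G4WK Γ (some ψ) → G4WK Γ (some (Form.or φ ψ))
  | impR (Γ φ ψ) : G4WK (φ ::ₘ Γ) (some ψ) → G4WK Γ (some (Form.imp φ ψ))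
  | andImpL (Γ φ ψ χ Δ) :
      G4WK (Form.imp φ (Form.imp ψ χ) ::ₘ Γ) Δ →
      G4WK (Form.imp (Form.and φ ψ) χ ::ₘ Γ) Δ
  | orImpL (Γ φ ψ χ Δ) :
      G4WK (Form.imp φ χ ::ₘ Form.imp ψ χ ::ₘ Γ) Δ →
      G4WK (Form.imp (Form.or φ ψ) χ ::ₘ Γ) Δ
  | pImpL (Γ n φ Δ) :
      G4WK (Form.var n ::ₘ φ ::ₘ Γ) Δ →
      G4WK (Form.var n ::ₘ Form.imp (Form.var n) φ ::ₘ Γ) Δ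
  | impImpL (Γ φ ψ χ Δ) :
      G4WK (Form.imp ψ χ ::ₘ Γ) (some (Form.imp φ ψ)) → G4WK (χ ::ₘ Γ) Δ →
      G4WK (Form.imp (Form.imp φ ψ) χ ::ₘ Γ) Δ
  | boxR (Γ φ) : G4WK (boxInv Γ) (some φ) → G4WK Γ (some (Form.box φ))
  | boxImpL (Γ φ ψ Δ) :
      G4WK (boxInv Γ) (some φ) → G4WK (ψ ::ₘ Γ) Δ →
      G4WK (Form.imp (Form.box φ) ψ ::ₘ Γ) Δ
  | diaImpL (Γ γ φ ψ Δ) :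
      G4WK (γ ::ₘ boxInv Γ) (some φ) → G4WK (ψ ::ₘ Form.dia γ ::ₘ Γ) Δ →
      G4WK (Form.imp (Form.dia φ) ψ ::ₘ Form.dia γ ::ₘ Γ) Δ
  | diaL' (Γ φ Δ) : G4WK (φ ::ₘ boxInv Γ) (diaInv Δ) → G4WK (Form.dia φ ::ₘ Γ) Δ

/-- Axiom schemes of the generalised Hilbert calculus CKH:
intuitionistic axioms A1–A9 together with K_□ and K_◇. -/
inductive CKAx : Form → Prop
  | a1 (φ ψ : Form) : CKAx (φ.imp (ψ.imp φ))
  | a2 (φ ψ χ : Form) : CKAx ((φ.imp (ψ.imp χ)).imp ((φ.imp ψ).imp (φ.imp χ)))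
  | a3 (φ ψ : Form) : CKAx (φ.imp (φ.or ψ))
  | a4 (φ ψ : Form) : CKAx (ψ.imp (φ.or ψ))
  | a5 (φ ψ χ : Form) : CKAx ((φ.imp χ).imp ((ψ.imp χ).imp ((φ.or ψ).imp χ)))
  | a6 (φ ψ : Form) : CKAx ((φ.and ψ).imp φ)
  | a7 (φ ψ : Form) : CKAx ((φ.and ψ).imp ψ)
  | a8 (φ ψ χ : Form) : CKAx ((φ.imp ψ).imp ((φ.imp χ).imp (φ.imp (ψ.and χ))))
  | a9 (φ : Form) : CKAx (Form.bot.imp φ)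
  | kbox (φ ψ : Form) : CKAx ((φ.imp ψ).box.imp (φ.box.imp ψ.box))
  | kdia (φ ψ : Form) : CKAx ((φ.imp ψ).box.imp (φ.dia.imp ψ.dia))

/-- Axiom schemes of WKH: those of CKH together with N : ¬◇⊥. -/
inductive WKAx : Form → Prop
  | ck {φ : Form} : CKAx φ → WKAx φ
  | n : WKAx (Form.bot.dia.imp Form.bot)

/-- Derivability Γ ⊢ φ in the generalised Hilbert calculus CKH. -/
inductive CKH : Set Form → Form → Prop
  | ax {Γ : Set Form} {φ : Form} : CKAx φ → CKH Γ φ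
  | el {Γ : Set Form} {φ : Form} : φ ∈ Γ → CKH Γ φ
  | mp {Γ : Set Form} {φ ψ : Form} : CKH Γ φ → CKH Γ (φ.imp ψ) → CKH Γ ψ
  | nec {Γ : Set Form} {φ : Form} : CKH ∅ φ → CKH Γ φ.box

/-- Derivability Γ ⊢ φ in the generalised Hilbert calculus WKH. -/
inductive WKH : Set Form → Form → Prop
  | ax {Γ : Set Form} {φ : Form} : WKAx φ → WKH Γ φ
  | el {Γ : Set Form} {φ : Form} : φ ∈ Γ → WKH Γ φ
  | mp {Γ : Set Form} {φ ψ : Form} : WKH Γ φ → WKH Γ (φ.imp ψ) → WKH Γ ψ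
  | nec {Γ : Set Form} {φ : Form} : WKH ∅ φ → WKH Γ φ.box

/-- The set of propositional variables occurring in a formula. -/
def vars : Form → Set ℕ
  | .var n => {n}
  | .bot => ∅
  | .and φ ψ => vars φ ∪ vars ψ
  | .or φ ψ => vars φ ∪ vars ψ
  | .imp φ ψ => vars φ ∪ vars ψ
  | .box φ => vars φ
  | .dia φ => vars φ

/-- Variables occurring in a multiset of formulas. -/
def varsM (Γ : Multiset Form) : Set ℕ := {n | ∃ φ ∈ Γ, n ∈ vars φ}

/-- Variables occurring in a succedent with at most one formula. -/
def varsO : Option Form → Set ℕ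
  | none => ∅
  | some φ => vars φ

namespace CKH

theorem weaken {Γ : Set Form} {φ ψ : Form} (h : CKH Γ φ) : CKH Γ (ψ.imp φ) :=
  mp h (ax (.a1 φ ψ))

theorem mp_under {Γ : Set Form} {φ ψ χ : Form} (h : CKH Γ (φ.imp (ψ.imp χ)))
    (h' : CKH Γ (φ.imp ψ)) : CKH Γ (φ.imp χ) :=
  mp h' (mp h (ax (.a2 φ ψ χ)))

theorem imp_trans {Γ : Set Form} {φ ψ χ : Form} (h : CKH Γ (φ.imp ψ))
    (h' : CKH Γ (ψ.imp χ)) : CKH Γ (φ.imp χ) :=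
  mp_under (weaken h') h

theorem imp_self {Γ : Set Form} (φ : Form) : CKH Γ (φ.imp φ) :=
  mp_under (ax (.a1 φ (φ.imp φ))) (ax (.a1 φ φ))

theorem precomp {Γ : Set Form} {φ ψ : Form} (h : CKH Γ (φ.imp ψ)) (χ : Form) :
    CKH Γ ((ψ.imp χ).imp (φ.imp χ)) :=
  mp_under (imp_trans (ax (.a1 (ψ.imp χ) φ)) (ax (.a2 φ ψ χ))) (weaken h)

theorem postcomp {Γ : Set Form} {ψ χ : Form} (h : CKH Γ (ψ.imp χ)) (φ : Form) :
    CKH Γ ((φ.imp ψ).imp (φ.imp χ)) :=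
  mp (weaken h) (ax (.a2 φ ψ χ))

theorem contract {Γ : Set Form} (φ ψ : Form) :
    CKH Γ ((φ.imp (φ.imp ψ)).imp (φ.imp ψ)) :=
  mp_under (ax (.a2 φ φ ψ)) (weaken (imp_self φ))

end CKH

/-- In CK, the universal uniform interpolant A of φ→ψ w.r.t. p is
equivalent to its relativisation B→A by the existential uniform
interpolant B of φ w.r.t. p. -/
theorem CK_forall_imp_eq_relativised :
    ∀ (φ ψ A B : Form) (p : ℕ),
      -- A is a uniform pre-interpolant of φ→ψ w.r.t. p
      vars A ⊆ vars (φ.imp ψ) \ {p} →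
      CKH ∅ (A.imp (φ.imp ψ)) →
      (∀ χ : Form, p ∉ vars χ → CKH ∅ (χ.imp (φ.imp ψ)) → CKH ∅ (χ.imp A)) →
      -- B is a uniform post-interpolant of φ w.r.t. p
      vars B ⊆ vars φ \ {p} →
      CKH ∅ (φ.imp B) →
      (∀ χ : Form, p ∉ vars χ → CKH ∅ (φ.imp χ) → CKH ∅ (B.imp χ)) →
      -- conclusions
      CKH ∅ (A.imp (B.imp A)) ∧ CKH ∅ ((B.imp A).imp A) ∧
      (CKH ∅ A ↔ CKH ∅ (B.imp A)) := by
  intro φ ψ A B p hA hAφψ hAmax hB hφB _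
  have hp : p ∉ vars (B.imp A) := by
    rintro (h | h)
    · exact (hB h).2 rfl
    · exact (hA h).2 rfl
  have hrel : CKH ∅ ((B.imp A).imp A) :=
    hAmax _ hp (((hφB.precomp A).imp_trans (hAφψ.postcomp φ)).imp_trans (.contract φ ψ))
  exact ⟨.ax (.a1 A B), hrel, .weaken, fun h => h.mp hrel⟩
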